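/- Let λ>0, σ>0, m∈ℕ₀ and t∈[-1,1]. Then Z_m^λ(t) = κ·∫_{-1}^1∫_{-1}^1 Z_m^{λ+σ}(((1-z₁)/2)·t + ((1+z₁)/2)·z₂)·(1-z₁)^λ(1+z₁)^{σ-1}(1-z₂²)^{σ-1/2} dz₁ dz₂, where κ = (∫_{-1}^1∫_{-1}^1 (1-z₁)^λ(1+z₁)^{σ-1}(1-z₂²)^{σ-1/2} dz₁ dz₂)^{-1}. -/

import Mathlib

open MeasureTheory Real Filter Set
open scoped RealInnerProductSpace ENNReal

noncomputable section

/-- Pochhammer symbol `(a)_n = a(a+1)⋯(a+n-1)`. -/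
def poch (a : ℝ) (n : ℕ) : ℝ := ∏ i ∈ Finset.range n, (a + i)

/-- Jacobi polynomial `P_n^{(a,b)}(t)` via its hypergeometric expansion. -/
def jacobiP (n : ℕ) (a b : ℝ) (t : ℝ) : ℝ :=
  (poch (a + 1) n / (n.factorial : ℝ)) *
    ∑ j ∈ Finset.range (n + 1),
      (poch (-(n : ℝ)) j * poch ((n : ℝ) + a + b + 1) j) /
        (poch (a + 1) j * (j.factorial : ℝ)) * ((1 - t) / 2) ^ j

/-- Squared norm `h_n^{(a,b)}` of the Jacobi polynomials. -/
def hJ (n : ℕ) (a b : ℝ) : ℝ :=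
  (poch (a + 1) n * poch (b + 1) n * (a + b + (n : ℝ) + 1)) /
    ((n.factorial : ℝ) * poch (a + b + 2) n * (a + b + 2 * (n : ℝ) + 1))

/-- Normalization constant `c_{a,b}` of the Jacobi weight. -/
def cJ (a b : ℝ) : ℝ := Real.Gamma (a + b + 2) / (Real.Gamma (a + 1) * Real.Gamma (b + 1))

/-- Generalized binomial coefficient `C(n+δ, n) = (δ+1)_n/n!`. -/
def binomC (δ : ℝ) (n : ℕ) : ℝ := poch (δ + 1) n / (n.factorial : ℝ)

/-- The parabolic domain `𝕌 = {(x₁,x₂) : x₁² ≤ x₂ ≤ 1}`. -/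
def Udom : Set (ℝ × ℝ) := {x | x.1 ^ 2 ≤ x.2 ∧ x.2 ≤ 1}

/-- The curved part `𝕌₀` of the boundary of `𝕌`. -/
def Udom0 : Set (ℝ × ℝ) := {x ∈ Udom | x.2 = x.1 ^ 2}

/-- The weight `U_{a,b}` on the parabolic domain. -/
def Uw (a b : ℝ) (x : ℝ × ℝ) : ℝ := (1 - x.2) ^ a * (x.2 - x.1 ^ 2) ^ (b - 1/2)

/-- Normalization constant `d_{a,b}` of `U_{a,b}`. -/
def dU (a b : ℝ) : ℝ := (∫ x in Udom, Uw a b x)⁻¹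

/-- The weighted measure `U_{a,b}(x) dx` on `𝕌`. -/
def μU (a b : ℝ) : Measure (ℝ × ℝ) :=
  (volume.restrict Udom).withDensity fun x => ENNReal.ofReal (Uw a b x)

/-- The orthogonal basis `P_{k,n}^{a,b}` on the parabolic domain (with the continuous
extension to `x₂ = 0`, where in Lean `x₁/√x₂ = 0` and `(√x₂)^k = 0` for `k ≥ 1`). -/
def PknU (a b : ℝ) (k n : ℕ) (x : ℝ × ℝ) : ℝ :=
  jacobiP (n - k) (b + (k : ℝ)) a (1 - 2 * x.2) * (Real.sqrt x.2) ^ k *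
    jacobiP k (b - 1/2) (b - 1/2) (x.1 / Real.sqrt x.2)

/-- Squared norms `h_{k,n}^{a,b}`. -/
def hknU (a b : ℝ) (k n : ℕ) : ℝ :=
  (cJ b a / cJ (b + (k : ℝ)) a) * hJ (n - k) (b + (k : ℝ)) a * hJ k (b - 1/2) (b - 1/2)

/-- Reproducing kernel `P_n(U_{a,b}; x, y)` on the parabolic domain. -/
def PnU (a b : ℝ) (n : ℕ) (x y : ℝ × ℝ) : ℝ :=
  ∑ k ∈ Finset.range (n + 1), PknU a b k n x * PknU a b k n y / hknU a b k n

/-- Partial-sum kernel `K_n(U_{a,b}; x, y)`. -/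
def KnU (a b : ℝ) (n : ℕ) (x y : ℝ × ℝ) : ℝ :=
  ∑ m ∈ Finset.range (n + 1), PnU a b m x y

/-- Cesàro `(C,δ)` kernel `K_n^δ(U_{a,b}; x, y)`. -/
def KnUCes (a b δ : ℝ) (n : ℕ) (x y : ℝ × ℝ) : ℝ :=
  (binomC δ n)⁻¹ * ∑ m ∈ Finset.range (n + 1), binomC (δ - 1) (n - m) * KnU a b m x y

/-- Cesàro `(C,δ)` means `S_n^δ(U_{a,b}; f, x)`. -/
def SnUCes (a b δ : ℝ) (n : ℕ) (f : ℝ × ℝ → ℝ) (x : ℝ × ℝ) : ℝ :=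
  dU a b * ∫ y in Udom, f y * KnUCes a b δ n x y * Uw a b y

/-- `Z_m^λ`, the normalized Gegenbauer polynomial (`2T_m` in the limiting case `λ = 0`). -/
def Zm (lam : ℝ) (m : ℕ) (t : ℝ) : ℝ :=
  if lam = 0 then (if m = 0 then 1 else 2 * (Polynomial.Chebyshev.T ℝ (m : ℤ)).eval t)
  else ((m : ℝ) + lam) / lam * (poch (2 * lam) m / poch (lam + 1/2) m) *
    jacobiP m (lam - 1/2) (lam - 1/2) t

/-- Euclidean space `ℝ^d`. -/
abbrev Euc (d : ℕ) := EuclideanSpace ℝ (Fin d)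

/-- The surface measure on the unit sphere `𝕊^{d-1}`. -/
def sphMeas (d : ℕ) : Measure (Metric.sphere (0 : Euc d) 1) :=
  (volume : Measure (Euc d)).toSphere

/-- The surface area `ω_d` of the unit sphere. -/
def ωd (d : ℕ) : ℝ := (sphMeas d Set.univ).toReal

/-- Integral over the unit sphere. -/
def sphInt (d : ℕ) (f : Euc d → ℝ) : ℝ := ∫ ξ, f (ξ : Euc d) ∂(sphMeas d)

/-- Integral over the surface of the paraboloid `𝕍₀^{d+1}`:
`∫_{𝕍₀} f dσ = ∫_0^1 t^{(d-1)/2} ∫_{𝕊^{d-1}} f(√t ξ, t) dσ_𝕊(ξ) dt`. -/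
def V0Int (d : ℕ) (f : Euc d → ℝ → ℝ) : ℝ :=
  ∫ t in (0:ℝ)..1, t ^ (((d : ℝ) - 1) / 2) * ∫ ξ, f (Real.sqrt t • (ξ : Euc d)) t ∂(sphMeas d)

/-- The weight `ϖ_{β,γ}(t) = t^β (1-t)^γ`. -/
def wt (β γ : ℝ) (t : ℝ) : ℝ := t ^ β * (1 - t) ^ γ

/-- Normalization constant `b_{β,γ}` on the surface of the paraboloid. -/
def bV0 (d : ℕ) (β γ : ℝ) : ℝ := (V0Int d fun _ t => wt β γ t)⁻¹

/-- The surface of the paraboloid `𝕍₀^{d+1} = {(x,t) : ‖x‖² = t ≤ 1}`. -/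
def V0set (d : ℕ) : Set (Euc d × ℝ) := {q | ‖q.1‖ ^ 2 = q.2 ∧ q.2 ≤ 1}

/-- The weighted measure `ϖ_{β,γ} dσ` on (the sphere-parametrization of) `𝕍₀^{d+1}`. -/
def μV0 (d : ℕ) (β γ : ℝ) : Measure (Metric.sphere (0 : Euc d) 1 × ℝ) :=
  ((sphMeas d).prod (volume.restrict (Set.Icc (0:ℝ) 1))).withDensity
    fun p => ENNReal.ofReal (p.2 ^ (((d : ℝ) - 1) / 2) * wt β γ p.2)

/-- Squared norms `h_{m,n}^{β,γ}` on the surface of the paraboloid. -/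
def hV0 (d : ℕ) (β γ : ℝ) (m n : ℕ) : ℝ :=
  (cJ (β + ((d : ℝ) - 1) / 2) γ / cJ ((m : ℝ) + β + ((d : ℝ) - 1) / 2) γ) *
    hJ (n - m) ((m : ℝ) + β + ((d : ℝ) - 1) / 2) γ

/-- The reproducing kernel `P_n(ϖ_{β,γ}; (√t ξ, t), (√s η, s))` on `𝕍₀^{d+1}`,
written as a function of `t`, `s` and `c = ⟨ξ,η⟩`. -/
def PnV0 (d : ℕ) (β γ : ℝ) (n : ℕ) (t s c : ℝ) : ℝ :=
  ∑ m ∈ Finset.range (n + 1),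
    jacobiP (n - m) ((m : ℝ) + β + ((d : ℝ) - 1) / 2) γ (1 - 2 * t) *
      jacobiP (n - m) ((m : ℝ) + β + ((d : ℝ) - 1) / 2) γ (1 - 2 * s) / hV0 d β γ m n *
      (Real.sqrt t) ^ m * (Real.sqrt s) ^ m * Zm (((d : ℝ) - 2) / 2) m c

/-- Partial-sum kernel `K_n(ϖ_{β,γ})` on `𝕍₀^{d+1}`. -/
def KnV0 (d : ℕ) (β γ : ℝ) (n : ℕ) (t s c : ℝ) : ℝ :=
  ∑ m ∈ Finset.range (n + 1), PnV0 d β γ m t s c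

/-- Cesàro `(C,δ)` kernel on `𝕍₀^{d+1}`. -/
def KnV0Ces (d : ℕ) (β γ δ : ℝ) (n : ℕ) (t s c : ℝ) : ℝ :=
  (binomC δ n)⁻¹ * ∑ m ∈ Finset.range (n + 1), binomC (δ - 1) (n - m) * KnV0 d β γ m t s c

/-- Cesàro `(C,δ)` means `S_n^δ(ϖ_{β,γ}; f, (√t ξ, t))` on `𝕍₀^{d+1}`. -/
def SnV0Ces (d : ℕ) (β γ δ : ℝ) (n : ℕ) (f : Euc d × ℝ → ℝ) (ξ : Euc d) (t : ℝ) : ℝ :=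
  bV0 d β γ * ∫ s in (0:ℝ)..1, s ^ (((d : ℝ) - 1) / 2) * wt β γ s *
    ∫ η, f (Real.sqrt s • (η : Euc d), s) * KnV0Ces d β γ δ n t s ⟪ξ, (η : Euc d)⟫ ∂(sphMeas d)

/-- Normalization constant `τ_β` in the definition of `T_{β,γ}`. -/
def τβ (d : ℕ) (β : ℝ) : ℝ :=
  (∫ z₁ in (-1:ℝ)..1, ∫ z₂ in (-1:ℝ)..1,
    (1 - z₁) ^ (((d : ℝ) - 2) / 2) * (1 + z₁) ^ (β - 1/2) * (1 - z₂ ^ 2) ^ β)⁻¹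

/-- The operator `T_{β,γ}` on the surface of the paraboloid, with
`(x,t) = (√t ξ, t)` and `(y,s) = (√s η, s)`. -/
def TV0 (d : ℕ) (β γ : ℝ) (g : ℝ × ℝ → ℝ × ℝ → ℝ) (ξ η : Euc d) (t s : ℝ) : ℝ :=
  if β = -(1/2) then g (Real.sqrt t, t) (⟪ξ, Real.sqrt s • η⟫, s)
  else τβ d β * ∫ z₁ in (-1:ℝ)..1, ∫ z₂ in (-1:ℝ)..1,
    g (Real.sqrt t, t) (Real.sqrt s * ((1 - z₁) / 2 * ⟪ξ, η⟫ + (1 + z₁) / 2 * z₂), s) *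
      ((1 - z₁) ^ (((d : ℝ) - 2) / 2) * (1 + z₁) ^ (β - 1/2) * (1 - z₂ ^ 2) ^ β)

/-- The pseudo convolution `f ∗_{𝕍₀} g` on the surface of the paraboloid. -/
def convV0 (d : ℕ) (β γ : ℝ) (f : Euc d × ℝ → ℝ) (g : ℝ × ℝ → ℝ × ℝ → ℝ)
    (η : Euc d) (s : ℝ) : ℝ :=
  bV0 d β γ * ∫ t in (0:ℝ)..1, t ^ (((d : ℝ) - 1) / 2) * wt β γ t *
    ∫ ξ, f (Real.sqrt t • (ξ : Euc d), t) * TV0 d β γ g (ξ : Euc d) η t s ∂(sphMeas d)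

/-- The solid paraboloid `𝕍^{d+1} = {(x,t) : ‖x‖² ≤ t ≤ 1}`. -/
def Vset (d : ℕ) : Set (Euc d × ℝ) := {q | ‖q.1‖ ^ 2 ≤ q.2 ∧ q.2 ≤ 1}

/-- The weight `W_{β,γ,μ}` on the solid paraboloid. -/
def WW (d : ℕ) (β γ μ : ℝ) (q : Euc d × ℝ) : ℝ :=
  q.2 ^ β * (1 - q.2) ^ γ * (q.2 - ‖q.1‖ ^ 2) ^ (μ - 1/2)

/-- Normalization constant `b_{β,γ,μ}`. -/
def bW (d : ℕ) (β γ μ : ℝ) : ℝ := (∫ q in Vset d, WW d β γ μ q)⁻¹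

/-- The weighted measure `W_{β,γ,μ}(x,t) dx dt` on `𝕍^{d+1}`. -/
def μW (d : ℕ) (β γ μ : ℝ) : Measure (Euc d × ℝ) :=
  (volume.restrict (Vset d)).withDensity fun q => ENNReal.ofReal (WW d β γ μ q)

/-- The weight `ϖ_μ(y) = (1-‖y‖²)^{μ-1/2}` on the unit ball. -/
def wB (d : ℕ) (μ : ℝ) (y : Euc d) : ℝ := (1 - ‖y‖ ^ 2) ^ (μ - 1/2)

/-- Normalization constant `b_μ` of `ϖ_μ` on the unit ball. -/
def bB (d : ℕ) (μ : ℝ) : ℝ := (∫ y in Metric.closedBall (0 : Euc d) 1, wB d μ y)⁻¹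

/-- Normalization constant `σ_μ = (∫_{-1}^1 (1-u²)^{μ-1} du)⁻¹`. -/
def σμ (μ : ℝ) : ℝ := (∫ u in (-1:ℝ)..1, (1 - u ^ 2) ^ (μ - 1))⁻¹

/-- `ξ₀(x,t,y,s;u) = (⟨x,y⟩ + u √(t-‖x‖²) √(s-‖y‖²))/√(st)`. -/
def xi0 (d : ℕ) (x : Euc d) (t : ℝ) (y : Euc d) (s : ℝ) (u : ℝ) : ℝ :=
  (⟪x, y⟫ + u * Real.sqrt (t - ‖x‖ ^ 2) * Real.sqrt (s - ‖y‖ ^ 2)) / Real.sqrt (s * t)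

/-- Squared norms `h_{m,n}^{β,γ,μ}` on the solid paraboloid. -/
def hW (d : ℕ) (β γ μ : ℝ) (m n : ℕ) : ℝ :=
  (cJ (β + μ + ((d : ℝ) - 1) / 2) γ / cJ ((m : ℝ) + β + μ + ((d : ℝ) - 1) / 2) γ) *
    hJ (n - m) ((m : ℝ) + β + μ + ((d : ℝ) - 1) / 2) γ

/-- The reproducing kernel `P_n(W_{β,γ,μ}; (x,t), (y,s))` on the solid paraboloid. -/
def PnW (d : ℕ) (β γ μ : ℝ) (n : ℕ) (x : Euc d) (t : ℝ) (y : Euc d) (s : ℝ) : ℝ :=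
  σμ μ * ∫ u in (-1:ℝ)..1,
    (∑ m ∈ Finset.range (n + 1),
      jacobiP (n - m) ((m : ℝ) + β + μ + ((d : ℝ) - 1) / 2) γ (1 - 2 * t) *
        jacobiP (n - m) ((m : ℝ) + β + μ + ((d : ℝ) - 1) / 2) γ (1 - 2 * s) / hW d β γ μ m n *
        (Real.sqrt t) ^ m * (Real.sqrt s) ^ m *
        Zm (μ + ((d : ℝ) - 1) / 2) m (xi0 d x t y s u)) * (1 - u ^ 2) ^ (μ - 1)

/-- Partial-sum kernel `K_n(W_{β,γ,μ})`. -/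
def KnW (d : ℕ) (β γ μ : ℝ) (n : ℕ) (x : Euc d) (t : ℝ) (y : Euc d) (s : ℝ) : ℝ :=
  ∑ m ∈ Finset.range (n + 1), PnW d β γ μ m x t y s

/-- Cesàro `(C,δ)` kernel on the solid paraboloid. -/
def KnWCes (d : ℕ) (β γ μ δ : ℝ) (n : ℕ) (x : Euc d) (t : ℝ) (y : Euc d) (s : ℝ) : ℝ :=
  (binomC δ n)⁻¹ * ∑ m ∈ Finset.range (n + 1), binomC (δ - 1) (n - m) * KnW d β γ μ m x t y s

/-- Cesàro `(C,δ)` means `S_n^δ(W_{β,γ,μ}; f, (x,t))`. -/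
def SnWCes (d : ℕ) (β γ μ δ : ℝ) (n : ℕ) (f : Euc d × ℝ → ℝ) (x : Euc d) (t : ℝ) : ℝ :=
  bW d β γ μ * ∫ q in Vset d, f q * KnWCes d β γ μ δ n x t q.1 q.2 * WW d β γ μ q

/-- `ξ(x,t,y,s;z,u)` in the connection kernel on the solid paraboloid. -/
def ξW (d : ℕ) (x : Euc d) (t : ℝ) (y : Euc d) (s : ℝ) (z₁ z₂ u : ℝ) : ℝ :=
  (1 - z₁) / 2 * xi0 d x t y s u + (1 + z₁) / 2 * z₂

/-- Normalization constant `κ_β`. -/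
def κβ (d : ℕ) (β μ : ℝ) : ℝ :=
  (∫ z₁ in (-1:ℝ)..1, ∫ z₂ in (-1:ℝ)..1, ∫ u in (-1:ℝ)..1,
    (1 - z₁) ^ (μ + ((d : ℝ) - 1) / 2) * (1 + z₁) ^ (β - 1) * (1 - z₂ ^ 2) ^ (β - 1/2) *
      (1 - u ^ 2) ^ (μ - 1))⁻¹

/-- The operator `T_{β,γ,μ}` on the solid paraboloid. -/
def TW (d : ℕ) (β γ μ : ℝ) (g : ℝ × ℝ → ℝ × ℝ → ℝ) (x : Euc d) (t : ℝ) (y : Euc d) (s : ℝ) : ℝ :=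
  if β = 0 then
    σμ μ * ∫ u in (-1:ℝ)..1,
      g (Real.sqrt t, t) (Real.sqrt s * xi0 d x t y s u, s) * (1 - u ^ 2) ^ (μ - 1)
  else
    κβ d β μ * ∫ z₁ in (-1:ℝ)..1, ∫ z₂ in (-1:ℝ)..1, ∫ u in (-1:ℝ)..1,
      g (Real.sqrt t, t) (Real.sqrt s * ξW d x t y s z₁ z₂ u, s) *
        ((1 - z₁) ^ (μ + ((d : ℝ) - 1) / 2) * (1 + z₁) ^ (β - 1) * (1 - z₂ ^ 2) ^ (β - 1/2) *
          (1 - u ^ 2) ^ (μ - 1))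

/-- Directional derivative `⟨x,∇⟩f(x) = ∑ xᵢ ∂ᵢ f(x)`. -/
def xGrad (d : ℕ) (f : Euc d → ℝ) (x : Euc d) : ℝ := fderiv ℝ f x x

/-- Laplacian `Δf(x) = ∑ ∂ᵢ² f(x)`. -/
def lapl (d : ℕ) (f : Euc d → ℝ) (x : Euc d) : ℝ :=
  ∑ i : Fin d, fderiv ℝ (fun y => fderiv ℝ f y (EuclideanSpace.single i 1)) x
    (EuclideanSpace.single i 1)


/-- `Q_{m,n}(x,t) = P_{n-m}^{(m+α,γ)}(1-2t) t^{m/2} Y(x/√t)`. -/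
def QV0gen (d : ℕ) (α γ : ℝ) (m n : ℕ) (Y : Euc d → ℝ) (x : Euc d) (t : ℝ) : ℝ :=
  jacobiP (n - m) ((m : ℝ) + α) γ (1 - 2 * t) * (Real.sqrt t) ^ m * Y ((Real.sqrt t)⁻¹ • x)

end

noncomputable section

lemma poch_zero' (a : ℝ) : poch a 0 = 1 := by simp [poch]
lemma poch_succ' (a : ℝ) (n : ℕ) : poch a (n+1) = poch a n * (a + n) := by
  simp [poch, Finset.prod_range_succ]
lemma poch_add' (a : ℝ) (m n : ℕ) : poch a (m+n) = poch a m * poch (a+m) n := by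
  simp only [poch, Finset.prod_range_add]
  congr 1
  apply Finset.prod_congr rfl
  intro i _
  push_cast; ring
lemma poch_one' (a : ℝ) : poch a 1 = a := by simp [poch]
lemma poch_succ_left' (a : ℝ) (n : ℕ) : poch a (n+1) = a * poch (a+1) n := by
  rw [add_comm n 1, poch_add', poch_one']; simp
lemma poch_pos' {a : ℝ} (ha : 0 < a) (n : ℕ) : 0 < poch a n := by
  unfold poch
  apply Finset.prod_pos
  intro i _
  positivity
lemma poch_two' (x : ℝ) (n : ℕ) : poch (2*x) (2*n) = 4^n * poch x n * poch (x+1/2) n := by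
  induction n with
  | zero => simp [poch]
  | succ n ih =>
    rw [show 2*(n+1) = 2*n+1+1 by ring, poch_succ', poch_succ', ih, poch_succ', poch_succ']
    push_cast; ring
lemma poch_neg' (y : ℝ) (j : ℕ) : poch (-y) j = (-1)^j * poch (y - j + 1) j := by
  induction j generalizing y with
  | zero => simp [poch]
  | succ j ih =>
    rw [poch_succ_left', show -y + 1 = -(y-1) by ring, ih, poch_succ']
    rw [show y - 1 - (j:ℝ) + 1 = y - ((j+1 : ℕ):ℝ) + 1 by push_cast; ring]
    push_cast; ring
lemma poch_negnat' (m n : ℕ) (h : n ≤ m) :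
    poch (-(m:ℝ)) n * ((m-n).factorial : ℝ) = (-1)^n * (m.factorial : ℝ) := by
  induction n with
  | zero => simp [poch]
  | succ n ih =>
    have := ih (by omega)
    obtain ⟨k, rfl⟩ := Nat.exists_eq_add_of_le h
    rw [show n + 1 + k - n = k+1 by omega, Nat.factorial_succ] at this
    rw [show n + 1 + k - (n+1) = k by omega, poch_succ', pow_succ]
    push_cast at *
    linear_combination -this

/-- binomial-type sequence -/
def pA (n : ℕ) : Polynomial ℝ :=
  match n with
  | 0 => 1
  | n+1 => Polynomial.X * ∏ i ∈ Finset.range n, (Polynomial.X + Polynomial.C ((n:ℝ) + 2 + i))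
def fA (n : ℕ) (x : ℝ) : ℝ := (pA n).eval x
lemma fA_zero (x : ℝ) : fA 0 x = 1 := by simp [fA, pA]
lemma fA_succ (n : ℕ) (x : ℝ) : fA (n+1) x = x * poch (x + n + 2) n := by
  simp [fA, pA, Polynomial.eval_prod, poch, add_assoc]
lemma fA_diff (n : ℕ) (x : ℝ) : fA (n+1) (x+1) - fA (n+1) x = (n+1) * fA n (x+2) := by
  cases n with
  | zero => simp [fA_zero, fA_succ, poch]
  | succ n =>
    rw [fA_succ, fA_succ, fA_succ, poch_succ', poch_succ_left']
    push_cast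
    rw [show x + 1 + ((n:ℝ)+1)+2 = x + 2 + n + 2 by ring,
      show x + ((n:ℝ)+1)+2+1 = x + 2 + n + 2 by ring]
    ring
lemma fA_conv (N : ℕ) : ∀ p y : ℝ,
    ∑ b ∈ Finset.range (N+1), (N.choose b : ℝ) * fA b p * fA (N-b) y = fA N (p+y) := by
  induction N with
  | zero => intro p y; simp [fA_zero]
  | succ N ih =>
    intro p y
    have hper : ∀ p : ℝ,
      (∑ b ∈ Finset.range (N+1+1), ((N+1).choose b : ℝ) * fA b (p+1) * fA (N+1-b) y)
        - (∑ b ∈ Finset.range (N+1+1), ((N+1).choose b : ℝ) * fA b p * fA (N+1-b) y)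
        = fA (N+1) (p+1+y) - fA (N+1) (p+y) := by
      intro p
      rw [show p+1+y = (p+y)+1 by ring, fA_diff, show p+y+2 = (p+2)+y by ring, ← ih,
        ← Finset.sum_sub_distrib, Finset.sum_range_succ', Finset.mul_sum]
      simp only [fA_zero, sub_self, add_zero]
      apply Finset.sum_congr rfl
      intro b _
      have h1 := fA_diff b p
      have h2 : ((N+1).choose (b+1) : ℝ) * (b+1) = (N+1) * (N.choose b : ℝ) := by
        have := Nat.add_one_mul_choose_eq N b
        exact_mod_cast this.symm
      rw [show N + 1 - (b+1) = N - b by omega]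
      linear_combination ((N+1).choose (b+1) : ℝ) * fA (N-b) y * h1 + fA b (p+2) * fA (N-b) y * h2
    have hnat : ∀ k : ℕ,
      (∑ b ∈ Finset.range (N+1+1), ((N+1).choose b : ℝ) * fA b k * fA (N+1-b) y)
        = fA (N+1) (k+y) := by
      intro k
      induction k with
      | zero =>
        rw [Finset.sum_range_succ']
        simp [fA_zero, fA_succ]
      | succ k ihk =>
        have := hper k
        push_cast
        linarith
    have hpoly : (∑ b ∈ Finset.range (N+1+1),
        Polynomial.C ((N+1).choose b : ℝ) * pA b * Polynomial.C (fA (N+1-b) y))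
        = (pA (N+1)).comp (Polynomial.X + Polynomial.C y) := by
      apply Polynomial.eq_of_infinite_eval_eq
      apply Set.Infinite.mono (s := Set.range (fun k : ℕ => (k:ℝ)))
      · rintro _ ⟨k, rfl⟩
        have := hnat k
        simp only [fA] at this
        simpa [Polynomial.eval_finsetSum, fA] using this
      · exact Set.infinite_range_of_injective Nat.cast_injective
    have := congrArg (Polynomial.eval p) hpoly
    simpa [Polynomial.eval_finsetSum, fA] using this

lemma poch_fA (p : ℝ) (b : ℕ) : poch p (2*b) = fA b p * poch (p+1) b := by
  cases b with
  | zero => simp [poch, fA_zero]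
  | succ n =>
    rw [fA_succ, show 2*(n+1) = (n+1+n)+1 by ring, poch_succ_left', poch_add' _ (n+1) n,
      show p + 1 + ((n+1:ℕ):ℝ) = p + n + 2 by push_cast; ring]
    ring
lemma L_lem (μ : ℝ) (hμ : 0 < μ) (m n : ℕ) (h : n ≤ m) :
    (m + μ)/μ * poch (2*μ) (m+n) = (-1)^(m-n) * fA (m-n) (-(2*m+2*μ)) * poch (2*μ+1) (2*n) := by
  obtain ⟨k, rfl⟩ := Nat.exists_eq_add_of_le h
  rw [show n + k - n = k by omega]
  cases k with
  | zero =>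
    have h1 := poch_succ' (2*μ) (2*n)
    rw [poch_succ_left'] at h1
    rw [fA_zero, show n+0+n = 2*n by ring]
    push_cast at *
    generalize poch (2*μ) (2*n) = u at *
    generalize poch (2*μ+1) (2*n) = v at *
    field_simp
    linear_combination -h1/2
  | succ j =>
    rw [fA_succ, show n + (j+1) + n = (2*n + j) + 1 by ring, poch_succ_left', poch_add' _ (2*n) j,
      show -(2 * ((n + (j + 1) : ℕ):ℝ) + 2 * μ) + j + 2 = -(2*n+j+2*μ) by push_cast; ring,
      poch_neg', show 2 * (n:ℝ) + j + 2 * μ - j + 1 = 2 * μ + 1 + ((2*n:ℕ):ℝ) by push_cast; ring,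
      pow_succ]
    have : ((-1:ℝ)^j)*(-1)^j = 1 := by rw [← mul_pow]; simp
    push_cast
    generalize poch (2*μ+1+2*n) j = u at *
    generalize poch (2*μ+1) (2*n) = v at *
    field_simp
    linear_combination (-v*u) * this

def Gc (μ : ℝ) (m n : ℕ) : ℝ :=
  (m+μ)/μ * poch (2*μ) m / (m.factorial:ℝ) *
    (poch (-(m:ℝ)) n * poch (m+2*μ) n / (poch (μ+1/2) n * (n.factorial:ℝ)))

lemma Gc_eq (μ : ℝ) (hμ : 0 < μ) (m n : ℕ) (h : n ≤ m) :
    Gc μ m n = (-1)^m * 4^n * poch (μ+1) n / ((n.factorial:ℝ) * ((m-n).factorial:ℝ))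
      * fA (m-n) (-(2*m+2*μ)) := by
  have h1 := L_lem μ hμ m n h
  have h2 := poch_negnat' m n h
  rw [poch_add'] at h1
  have h3 : poch (2*μ+1) (2*n) = 4^n * poch (μ+1/2) n * poch (μ+1) n := by
    rw [show 2*μ+1 = 2*(μ+1/2) by ring, poch_two', show μ+1/2+1/2 = μ+1 by ring]
  rw [h3] at h1
  have e1 : (-1:ℝ)^n * (-1)^(m-n) = (-1)^m := by rw [← pow_add]; congr 1; omega
  have p1 := poch_pos' (show 0 < μ+1/2 by linarith) n
  have f1 : (0:ℝ) < (m.factorial:ℝ) := by positivity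
  have f2 : (0:ℝ) < (n.factorial:ℝ) := by positivity
  have f3 : (0:ℝ) < ((m-n).factorial:ℝ) := by positivity
  unfold Gc
  rw [show (m:ℝ)+2*μ = 2*μ+m by ring]
  rw [← e1]
  generalize poch (-(m:ℝ)) n = u0 at *
  generalize poch (2*μ+m) n = u1 at *
  generalize poch (2*μ) m = u2 at *
  generalize poch (μ+1/2) n = u3 at *
  generalize poch (μ+1) n = u4 at *
  generalize (m.factorial:ℝ) = v1 at *
  generalize (n.factorial:ℝ) = v2 at *
  generalize ((m-n).factorial:ℝ) = v3 at *
  generalize fA (m-n) (-(2*m+2*μ)) = w at *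
  generalize (-1:ℝ)^(m-n) = e2 at *
  have : (m+μ)/μ * u2 * u1 * (u0 * v3) = (e2 * w * (4^n*u3*u4)) * ((-1)^n * v1) := by
    rw [h2, ← h1]; ring
  generalize (m+μ)/μ = r at *
  field_simp
  linear_combination this

lemma coef_sum (lam sig : ℝ) (hl : 0 < lam) (hs : 0 < sig) (a N : ℕ) :
    ∑ b ∈ Finset.range (N+1), Gc (lam+sig) (a+N) (a+b) * ((a+b).choose a : ℝ) *
      (poch (lam+1) a * poch sig b / poch (lam+1+sig) (a+b) *
       (poch (sig+1/2) b / poch (sig+1/2+(sig+1/2)) b)) = Gc lam (a+N) a := by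
  rw [Gc_eq lam hl (a+N) a (by omega)]
  have hc := fA_conv N (2*sig) (-(2*((a+N:ℕ):ℝ)+2*(lam+sig)))
  rw [show a + N - a = N by omega,
    show -(2*((a+N:ℕ):ℝ)+2*lam) = 2*sig + -(2*((a+N:ℕ):ℝ)+2*(lam+sig)) by ring, ← hc,
    Finset.mul_sum]
  apply Finset.sum_congr rfl
  intro b hb
  have hb : b ≤ N := by simpa [Nat.lt_succ_iff] using hb
  rw [Gc_eq (lam+sig) (by linarith) (a+N) (a+b) (by omega), show a + N - (a+b) = N - b by omega]
  have h2 := poch_fA (2*sig) b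
  rw [poch_two'] at h2
  have hch : ((a+b).choose a : ℝ) * (a.factorial:ℝ) * (b.factorial:ℝ) = ((a+b).factorial:ℝ) := by
    have := Nat.add_choose_mul_factorial_mul_factorial a b
    rw [← Nat.choose_symm_add] at this
    exact_mod_cast this
  have hch2 : (N.choose b : ℝ) * (b.factorial:ℝ) * ((N-b).factorial:ℝ) = (N.factorial:ℝ) := by
    have := Nat.choose_mul_factorial_mul_factorial hb
    exact_mod_cast this
  rw [show sig+1/2+(sig+1/2) = 2*sig+1 by ring, show lam+1+sig = lam+sig+1 by ring]
  have q1 := poch_pos' (show 0 < 2*sig+1 by linarith) b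
  have q2 := poch_pos' (show 0 < lam+sig+1 by linarith) (a+b)
  have f1 : (0:ℝ) < (a.factorial:ℝ) := by positivity
  have f2 : (0:ℝ) < (b.factorial:ℝ) := by positivity
  have f3 : (0:ℝ) < ((N-b).factorial:ℝ) := by positivity
  have f4 : (0:ℝ) < ((a+b).choose a : ℝ) := by
    exact_mod_cast Nat.choose_pos (by omega)
  have f5 : (0:ℝ) < (N.choose b : ℝ) := by
    exact_mod_cast Nat.choose_pos hb
  have h3 : fA b (2*sig) = 4^b * poch sig b * poch (sig+1/2) b / poch (2*sig+1) b := by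
    rw [h2]; field_simp
  rw [h3, ← hch, ← hch2, pow_add 4 a b]
  generalize fA (N-b) _ = w
  field_simp

lemma Gamma_poch (p : ℝ) (hp : 0 < p) (n : ℕ) : Real.Gamma (p + n) = poch p n * Real.Gamma p := by
  induction n with
  | zero => simp [poch]
  | succ n ih =>
    push_cast
    rw [← add_assoc, Real.Gamma_add_one (by positivity), ih, poch_succ']; ring

lemma beta_poch (p q : ℝ) (hp : 0 < p) (hq : 0 < q) (a b : ℕ) :
    ProbabilityTheory.beta (p+a) (q+b) = ProbabilityTheory.beta p q *
      (poch p a * poch q b / poch (p+q) (a+b)) := by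
  unfold ProbabilityTheory.beta
  rw [Gamma_poch p hp, Gamma_poch q hq,
    show p + a + (q+b) = (p+q) + ((a+b:ℕ):ℝ) by push_cast; ring, Gamma_poch (p+q) (by linarith)]
  have := Real.Gamma_pos_of_pos (show 0 < p+q by linarith)
  have := poch_pos' (show 0 < p+q by linarith) (a+b)
  field_simp

lemma beta_int (p q : ℝ) (hp : 0 < p) (hq : 0 < q) :
    IntervalIntegrable (fun x : ℝ => x^(p-1) * (1-x)^(q-1)) volume 0 1 ∧
    ∫ x in (0:ℝ)..1, x^(p-1) * (1-x)^(q-1) = ProbabilityTheory.beta p q := by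
  have hc := Complex.betaIntegral_convergent (u := p) (v := q) (by simpa) (by simpa)
  have heq : Set.EqOn (fun x : ℝ => (x:ℂ)^((p:ℂ)-1) * (1-(x:ℂ))^((q:ℂ)-1))
      (fun x : ℝ => ((x^(p-1) * (1-x)^(q-1) : ℝ) : ℂ)) (Set.uIcc 0 1) := by
    intro x hx
    rw [Set.uIcc_of_le zero_le_one] at hx
    simp only
    rw [Complex.ofReal_mul, Complex.ofReal_cpow hx.1, Complex.ofReal_cpow (by linarith [hx.2])]
    push_cast; rfl
  have hc' : IntervalIntegrable (fun x : ℝ => ((x^(p-1) * (1-x)^(q-1) : ℝ) : ℂ)) volume 0 1 := by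
    refine hc.congr ?_
    intro x hx
    exact heq (Set.uIoc_subset_uIcc hx)
  constructor
  · rw [intervalIntegrable_iff] at *
    have := hc'.re
    simp only [RCLike.re_to_complex, Complex.ofReal_re] at this
    exact this
  · rw [ProbabilityTheory.beta_eq_betaIntegralReal p q hp hq, Complex.betaIntegral,
      intervalIntegral.integral_congr heq, intervalIntegral.integral_ofReal, Complex.ofReal_re]

lemma mom (p q : ℝ) (hp : 0 < p) (hq : 0 < q) (a b : ℕ) :
    IntervalIntegrable (fun z : ℝ => ((1-z)/2)^a * ((1+z)/2)^b *
      ((1-z)^(p-1) * (1+z)^(q-1))) volume (-1) 1 ∧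
    ∫ z in (-1:ℝ)..1, ((1-z)/2)^a * ((1+z)/2)^b * ((1-z)^(p-1) * (1+z)^(q-1))
     = 2 * 2^(p-1) * 2^(q-1) * ProbabilityTheory.beta p q *
      (poch p a * poch q b / poch (p+q) (a+b)) := by
  obtain ⟨h1, h2⟩ := beta_int (p+a) (q+b) (by positivity) (by positivity)
  rw [beta_poch p q hp hq] at h2
  set f : ℝ → ℝ := fun x => x^(p+a-1) * (1-x)^(q+b-1) with hf
  have h3 : IntervalIntegrable (fun z => 2^(p-1) * 2^(q-1) * f (1/2 - z/2)) volume (-1) 1 := by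
    apply IntervalIntegrable.const_mul
    have := (h1.comp_sub_left (1/2)).comp_mul_left (c := (1/2:ℝ)) 
    norm_num at this
    convert this.symm using 1
    ext z; congr 1; ring
  have hae : Set.EqOn (fun z => 2^(p-1) * 2^(q-1) * f (1/2 - z/2)) (fun z : ℝ => ((1-z)/2)^a * ((1+z)/2)^b *
      ((1-z)^(p-1) * (1+z)^(q-1))) (Set.Ioo (-1) 1) := by
    intro z hz
    have k1 : 0 < (1-z)/2 := by linarith [hz.2]
    have k2 : 0 < (1+z)/2 := by linarith [hz.1]
    simp only [hf]
    rw [show 1/2 - z/2 = (1-z)/2 by ring, show 1 - (1-z)/2 = (1+z)/2 by ring,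
      show p+a-1 = (p-1)+a by ring, show q+b-1=(q-1)+b by ring, Real.rpow_add_natCast k1.ne',
      Real.rpow_add_natCast k2.ne']
    have e1 : (1-z)^(p-1) = 2^(p-1) * ((1-z)/2)^(p-1) := by
      rw [← Real.mul_rpow (by norm_num) k1.le]; congr 1; ring
    have e2 : (1+z)^(q-1) = 2^(q-1) * ((1+z)/2)^(q-1) := by
      rw [← Real.mul_rpow (by norm_num) k2.le]; congr 1; ring
    rw [e1, e2]; ring
  have hle : (-1:ℝ) ≤ 1 := by norm_num
  constructor
  · rw [intervalIntegrable_iff_integrableOn_Ioo_of_le hle] at *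
    exact h3.congr_fun hae measurableSet_Ioo
  · rw [intervalIntegral.integral_of_le hle, integral_Ioc_eq_integral_Ioo,
      ← setIntegral_congr_fun measurableSet_Ioo hae, ← integral_Ioc_eq_integral_Ioo,
      ← intervalIntegral.integral_of_le hle, intervalIntegral.integral_const_mul,
      intervalIntegral.integral_comp_sub_div _ (by norm_num)]
    norm_num
    rw [h2]
    ring

lemma Zm_eq (μ : ℝ) (hμ : 0 < μ) (m : ℕ) (y : ℝ) :
    Zm μ m y = ∑ j ∈ Finset.range (m+1), Gc μ m j * ((1-y)/2)^j := by
  unfold Zm jacobiP Gc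
  rw [if_neg hμ.ne', Finset.mul_sum, Finset.mul_sum]
  apply Finset.sum_congr rfl
  intro j _
  rw [show μ - 1/2 + 1 = μ + 1/2 by ring, show (m:ℝ) + (μ-1/2) + (μ-1/2) + 1 = m + 2*μ by ring]
  have := poch_pos' (show 0 < μ+1/2 by linarith) m
  generalize poch (μ+1/2) m = u at *
  generalize poch (μ+1/2) j = v at *
  field_simp

lemma int_sum {ι : Type} (S : Finset ι) (c : ι → ℝ) (f g : ι → ℝ → ℝ)
    (hf : ∀ i ∈ S, IntervalIntegrable (f i) volume (-1) 1)
    (hg : ∀ i ∈ S, IntervalIntegrable (g i) volume (-1) 1) :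
    ∫ z₁ in (-1:ℝ)..1, ∫ z₂ in (-1:ℝ)..1, ∑ i ∈ S, c i * (f i z₁ * g i z₂)
      = ∑ i ∈ S, c i * ((∫ z in (-1:ℝ)..1, f i z) * ∫ z in (-1:ℝ)..1, g i z) := by
  have h1 : ∀ z₁ : ℝ, ∫ z₂ in (-1:ℝ)..1, ∑ i ∈ S, c i * (f i z₁ * g i z₂)
      = ∑ i ∈ S, (c i * ∫ z in (-1:ℝ)..1, g i z) * f i z₁ := by
    intro z₁
    rw [intervalIntegral.integral_finsetSum]
    · apply Finset.sum_congr rfl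
      intro i _
      rw [intervalIntegral.integral_const_mul, intervalIntegral.integral_const_mul]
      ring
    · intro i hi
      exact ((hg i hi).const_mul _).const_mul _
  simp_rw [h1]
  rw [intervalIntegral.integral_finsetSum]
  · apply Finset.sum_congr rfl
    intro i _
    rw [intervalIntegral.integral_const_mul]
    ring
  · intro i hi
    exact (hf i hi).const_mul _

lemma mom2 (sig : ℝ) (hs : 0 < sig) (b : ℕ) :
    IntervalIntegrable (fun z : ℝ => ((1-z)/2)^b * (1-z^2)^(sig-1/2)) volume (-1) 1 ∧
    ∫ z in (-1:ℝ)..1, ((1-z)/2)^b * (1-z^2)^(sig-1/2)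
     = 2 * 2^(sig+1/2-1) * 2^(sig+1/2-1) * ProbabilityTheory.beta (sig+1/2) (sig+1/2) *
      (poch (sig+1/2) b / poch (sig+1/2+(sig+1/2)) b) := by
  have h := mom (sig+1/2) (sig+1/2) (by linarith) (by linarith) b 0
  have heq : Set.EqOn (fun z : ℝ => ((1-z)/2)^b * (1-z^2)^(sig-1/2))
    (fun z : ℝ => ((1-z)/2)^b * ((1+z)/2)^0 *
      ((1-z)^(sig+1/2-1) * (1+z)^(sig+1/2-1))) (Set.uIcc (-1) 1) := by
    intro z hz
    rw [Set.uIcc_of_le (by norm_num)] at hz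
    simp only
    rw [← Real.mul_rpow (by linarith [hz.2]) (by linarith [hz.1]),
      show sig + 1/2 - 1 = sig - 1/2 by ring]
    ring_nf
  constructor
  · refine h.1.congr ?_
    intro x hx
    exact (heq (Set.uIoc_subset_uIcc hx)).symm
  · rw [intervalIntegral.integral_congr heq, h.2]
    simp [poch_zero']

end

/-- the integral identity raising the index of `Z_m^λ` to `Z_m^{λ+σ}`. -/
theorem stmt6 (lam sig : ℝ) (hlam : 0 < lam) (hsig : 0 < sig) (m : ℕ) (t : ℝ)
    (ht : t ∈ Set.Icc (-1:ℝ) 1) :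
    Zm lam m t =
      (∫ z₁ in (-1:ℝ)..1, ∫ z₂ in (-1:ℝ)..1,
          (1 - z₁) ^ lam * (1 + z₁) ^ (sig - 1) * (1 - z₂ ^ 2) ^ (sig - 1/2))⁻¹ *
        ∫ z₁ in (-1:ℝ)..1, ∫ z₂ in (-1:ℝ)..1,
          Zm (lam + sig) m ((1 - z₁)/2 * t + (1 + z₁)/2 * z₂) *
            ((1 - z₁) ^ lam * (1 + z₁) ^ (sig - 1) * (1 - z₂ ^ 2) ^ (sig - 1/2)) := by
  have hmu : 0 < lam + sig := by linarith
  set s := (1-t)/2 with hs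
  set X : ℝ := 2 * 2^(lam+1-1) * 2^(sig-1) * ProbabilityTheory.beta (lam+1) sig with hX
  set Y : ℝ := 2 * 2^(sig+1/2-1) * 2^(sig+1/2-1) *
    ProbabilityTheory.beta (sig+1/2) (sig+1/2) with hY
  have hXp : 0 < X := by
    have := ProbabilityTheory.beta_pos (show 0 < lam+1 by linarith) hsig
    positivity
  have hYp : 0 < Y := by
    have := ProbabilityTheory.beta_pos (show 0 < sig+1/2 by linarith) (show 0 < sig+1/2 by linarith)
    positivity
  let f : ℕ → ℕ → ℝ → ℝ := fun a b z => ((1-z)/2)^a * ((1+z)/2)^b *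
      ((1-z)^(lam+1-1) * (1+z)^(sig-1))
  let g : ℕ → ℝ → ℝ := fun b z => ((1-z)/2)^b * (1-z^2)^(sig-1/2)
  have hf : ∀ a b, IntervalIntegrable (f a b) volume (-1) 1 ∧ ∫ z in (-1:ℝ)..1, f a b z =
      X * (poch (lam+1) a * poch sig b / poch (lam+1+sig) (a+b)) :=
    fun a b => mom (lam+1) sig (by linarith) hsig a b
  have hg : ∀ b, IntervalIntegrable (g b) volume (-1) 1 ∧ ∫ z in (-1:ℝ)..1, g b z =
      Y * (poch (sig+1/2) b / poch (sig+1/2+(sig+1/2)) b) :=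
    fun b => mom2 sig hsig b
  have hden : (∫ z₁ in (-1:ℝ)..1, ∫ z₂ in (-1:ℝ)..1,
          (1 - z₁) ^ lam * (1 + z₁) ^ (sig - 1) * (1 - z₂ ^ 2) ^ (sig - 1/2)) = X * Y := by
    have h := int_sum (Finset.range 1) (fun _ => 1) (fun _ => f 0 0) (fun _ => g 0)
      (fun _ _ => (hf 0 0).1) (fun _ _ => (hg 0).1)
    simp only [Finset.sum_range_one, (hf 0 0).2, (hg 0).2] at h
    simpa [f, g, poch_zero'] using h
  let S : Finset (Σ _ : ℕ, ℕ) := (Finset.range (m+1)).sigma (fun a => Finset.range (m+1-a))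
  have hnum : ∀ z₁ z₂ : ℝ, Zm (lam + sig) m ((1 - z₁)/2 * t + (1 + z₁)/2 * z₂) *
            ((1 - z₁) ^ lam * (1 + z₁) ^ (sig - 1) * (1 - z₂ ^ 2) ^ (sig - 1/2)) =
      ∑ i ∈ S, (Gc (lam+sig) m (i.1+i.2) * ((i.1+i.2).choose i.1 : ℝ) * s^i.1) *
        (f i.1 i.2 z₁ * g i.2 z₂) := by
    intro z₁ z₂
    rw [Finset.sum_sigma, ← Finset.sum_range_diag_flip (m+1) (fun a b =>
      (Gc (lam+sig) m (a+b) * ((a+b).choose a : ℝ) * s^a) * (f a b z₁ * g b z₂)),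
      Zm_eq _ hmu, Finset.sum_mul]
    apply Finset.sum_congr rfl
    intro j _
    rw [show (1 - ((1 - z₁)/2 * t + (1 + z₁)/2 * z₂))/2
      = (1-z₁)/2 * s + (1+z₁)/2 * ((1-z₂)/2) by rw [hs]; ring, add_pow, Finset.mul_sum,
      Finset.sum_mul]
    apply Finset.sum_congr rfl
    intro k hk
    have hk : k ≤ j := by simpa [Nat.lt_succ_iff] using hk
    rw [Nat.add_sub_cancel' hk]
    simp only [f, g, add_sub_cancel_right, mul_pow]
    ring
  rw [hden]
  simp_rw [hnum]
  rw [int_sum S _ (fun i => f i.1 i.2) (fun i => g i.2) (fun i _ => (hf _ _).1)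
    (fun i _ => (hg _).1), Finset.sum_sigma, Finset.mul_sum, Zm_eq lam hlam]
  apply Finset.sum_congr rfl
  intro a ha
  have ha : a ≤ m := by simpa [Nat.lt_succ_iff] using ha
  obtain ⟨N, rfl⟩ := Nat.exists_eq_add_of_le ha
  rw [← coef_sum lam sig hlam hsig, Finset.sum_mul, Finset.mul_sum,
    show a + N + 1 - a = N + 1 by omega]
  apply Finset.sum_congr rfl
  intro b _
  simp only [(hf _ _).2, (hg _).2]
  rw [← hs]
  clear_value X Y
  have hXY : (X * Y)⁻¹ * (X * Y) = 1 := inv_mul_cancel₀ (by positivity)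
  generalize poch (lam+1) a * poch sig b / poch (lam+1+sig) (a+b) = u
  generalize poch (sig+1/2) b / poch (sig+1/2+(sig+1/2)) b = v
  linear_combination (-(Gc (lam+sig) (a+N) (a+b) * ((a+b).choose a : ℝ) * s^a * (u * v))) * hXY
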